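/- Under the dense-layer setup (logits o j = ∑_{i} W i j · x i + b j, softmax p, one-hot label y with ∑_k y k = 1, cross-entropy loss L), for any class index j with p j o ≠ y j, every input coordinate is exactly recovered from the shared gradients: x i = (∂L/∂W i j) / (∂L/∂b j) for all i : Fin n. -/

import Mathlib

/-- Gradient inversion attack: under the dense-layer softmax–cross-entropy setup,
for any class `j` with `p_j ≠ y_j`, every input coordinate is recovered as
`x_i = (∂L/∂W_{ij}) / (∂L/∂b_j)`. -/
theorem gradient_inversion_recovers_input (n C : ℕ) (hn : 1 ≤ n) (hC : 1 ≤ C)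
    (p : (Fin C → ℝ) → Fin C → ℝ)
    (hp : ∀ o k, p o k = Real.exp (o k) / ∑ j, Real.exp (o j))
    (y : Fin C → ℝ) (hy : ∑ k, y k = 1)
    (L : (Fin C → ℝ) → ℝ)
    (hL : ∀ o, L o = -∑ k, y k * Real.log (p o k))
    (x : Fin n → ℝ) (W : Fin n → Fin C → ℝ) (b : Fin C → ℝ)
    (o : Fin C → ℝ) (ho : ∀ j, o j = (∑ i, W i j * x i) + b j)
    (Loss : (Fin n → Fin C → ℝ) → (Fin C → ℝ) → ℝ)
    (hLoss : ∀ W' b', Loss W' b' = L (fun j => (∑ i, W' i j * x i) + b' j))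
    (j : Fin C) (hne : p o j ≠ y j) :
    ∀ i : Fin n,
      x i = deriv (fun t => Loss (Function.update W i (Function.update (W i) j t)) b) (W i j)
              / deriv (fun t => Loss W (Function.update b j t)) (b j) := by
  intro i
  haveI : Nonempty (Fin C) := ⟨j⟩
  have hpos : ∀ u : Fin C → ℝ, 0 < ∑ k, Real.exp (u k) := fun u =>
    Finset.sum_pos (fun k _ => Real.exp_pos _) Finset.univ_nonempty
  have hL2 : ∀ u, L u = Real.log (∑ k, Real.exp (u k)) - ∑ k, y k * u k := by
    intro u
    rw [hL]
    have h1 : ∀ k, y k * Real.log (p u k)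
        = y k * u k - y k * Real.log (∑ k, Real.exp (u k)) := by
      intro k
      rw [hp, Real.log_div (Real.exp_pos _).ne' (hpos u).ne', Real.log_exp]
      ring
    simp only [h1]
    rw [Finset.sum_sub_distrib, ← Finset.sum_mul, hy]
    ring
  have hcoord : ∀ k, HasDerivAt (fun s => Function.update o j s k)
      ((Pi.single j (1 : ℝ) : Fin C → ℝ) k) (o j) := fun k =>
    (hasDerivAt_pi.1 (hasDerivAt_update o j (o j))) k
  have hself : Function.update o j (o j) = o := Function.update_eq_self j o
  have hg : HasDerivAt (fun s => L (Function.update o j s)) (p o j - y j) (o j) := by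
    simp only [hL2]
    have hA : HasDerivAt (fun s => ∑ k, Real.exp (Function.update o j s k))
        (Real.exp (o j)) (o j) := by
      have := HasDerivAt.fun_sum (u := Finset.univ) (fun k _ => (hcoord k).exp)
      simpa [hself, Pi.single_apply] using this
    have hB : HasDerivAt (fun s => ∑ k, y k * Function.update o j s k) (y j) (o j) := by
      have := HasDerivAt.fun_sum (u := Finset.univ) (fun k _ => (hcoord k).const_mul (y k))
      simpa [Pi.single_apply] using this
    have hC := (hA.log (hpos _).ne').sub hB
    rw [hself] at hC
    rw [hp]
    exact hC
  have e1 : (fun t => Loss (Function.update W i (Function.update (W i) j t)) b)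
      = fun t => L (Function.update o j (o j + (t - W i j) * x i)) := by
    funext t
    rw [hLoss]
    congr 1
    funext k
    have h2 : ∀ i', Function.update W i (Function.update (W i) j t) i' k * x i'
        = W i' k * x i' + (if i' = i then (if k = j then (t - W i j) * x i else 0) else 0) := by
      intro i'
      by_cases hi : i' = i
      · subst hi
        by_cases hk : k = j
        · subst hk
          simp
          ring
        · simp [hk]
      · simp [hi]
    simp only [h2]
    rw [Finset.sum_add_distrib]
    by_cases hk : k = j
    · subst hk
      simp [ho]
      ring
    · simp [hk, ho]
  have e2 : (fun t => Loss W (Function.update b j t))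
      = fun t => L (Function.update o j (o j + (t - b j))) := by
    funext t
    rw [hLoss]
    congr 1
    funext k
    by_cases hk : k = j
    · subst hk
      simp [ho]
    · simp [hk, ho]
  have d1 : HasDerivAt (fun t => L (Function.update o j (o j + (t - W i j) * x i)))
      ((p o j - y j) * x i) (W i j) := by
    have hin : HasDerivAt (fun t => o j + (t - W i j) * x i) (x i) (W i j) := by
      simpa using (((hasDerivAt_id (W i j)).sub_const (W i j)).mul_const (x i)).const_add (o j)
    exact HasDerivAt.comp (W i j) (h₂ := fun s => L (Function.update o j s))
      (by simpa using hg) hin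
  have d2 : HasDerivAt (fun t => L (Function.update o j (o j + (t - b j))))
      (p o j - y j) (b j) := by
    have hin : HasDerivAt (fun t => o j + (t - b j)) 1 (b j) := by
      simpa using ((hasDerivAt_id (b j)).sub_const (b j)).const_add (o j)
    have := HasDerivAt.comp (b j) (h₂ := fun s => L (Function.update o j s))
      (h₂' := p o j - y j) (by simpa using hg) hin
    rw [mul_one] at this
    exact this
  rw [e1, e2, d1.deriv, d2.deriv]
  have : p o j - y j ≠ 0 := sub_ne_zero.2 hne
  field_simp
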